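/- arXiv:0704.3698 — 2 statements merged into one kernel-verified Lean document; each statement's English description precedes it below -/
import Mathlib

section
/- Let K be a field of characteristic zero, let g be a finite-dimensional semisimple Lie algebra over K, let σ : g → g be a Lie algebra automorphism with σ ∘ σ = id, and let h = {x ∈ g : σ(x) = x}. Then h coincides with its normalizer in g: n_g(h) = h, where n_g(h) = {x ∈ g : [x, h] ⊆ h}. -/
/-- In a Lie algebra with nondegenerate Killing form, an element whose adjoint action squares to
zero vanishes. -/
theorem LieAlgebra.IsKilling.eq_zero_of_lie_lie_eq_zero
    {K : Type*} [Field K] [NeZero (2 : K)]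
    {L : Type*} [LieRing L] [LieAlgebra K L] [Module.Finite K L] [LieAlgebra.IsKilling K L]
    {z : L} (hz : ∀ u : L, ⁅z, ⁅z, u⁆⁆ = 0) : z = 0 := by
  have hcomm (w u : L) : ⁅⁅z, w⁆, ⁅z, u⁆⁆ = 0 := by
    have h2 : (2 : K) • ⁅⁅z, w⁆, ⁅z, u⁆⁆ = 0 := by
      have h0 := hz ⁅w, u⁆
      rwa [leibniz_lie z w, lie_add, leibniz_lie z ⁅z, w⁆, leibniz_lie z w ⁅z, u⁆, hz, hz,
        zero_lie, lie_zero, zero_add, add_zero, ← two_smul K] at h0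
    exact (smul_eq_zero.mp h2).resolve_left two_ne_zero
  refine (LieAlgebra.IsKilling.killingForm_nondegenerate K L).1 z fun w ↦ ?_
  rw [killingForm_apply_apply]
  refine (LinearMap.isNilpotent_trace_of_isNilpotent ⟨2, ?_⟩).eq_zero
  ext u
  simp [pow_two, leibniz_lie z w ⁅z, ⁅w, u⁆⁆, hz, hcomm]

/-- A symmetric subalgebra of a finite-dimensional semisimple Lie algebra over a field of
characteristic zero coincides with its normalizer. -/
theorem symmetric_subalgebra_selfnormalizing
    (K : Type*) [Field K] [CharZero K]
    (g : Type*) [LieRing g] [LieAlgebra K g] [Module.Finite K g]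
    [LieAlgebra.IsSemisimple K g]
    (σ : g →ₗ⁅K⁆ g) (hσ : ∀ x, σ (σ x) = x)
    (h : LieSubalgebra K g) (hmem : ∀ x, x ∈ h ↔ σ x = x) :
    h.normalizer = h := by
  refine le_antisymm (fun x hx ↦ ?_) h.le_normalizer
  have eq_zero_of_eq_neg {v : g} (hv : v = -v) : v = 0 := by
    have h2 : (2 : K) • v = 0 := by
      rw [two_smul]
      exact eq_neg_iff_add_eq_zero.mp hv
    exact (smul_eq_zero.mp h2).resolve_left two_ne_zero
  have hadd (u : g) : u + σ u ∈ h := by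
    rw [hmem, map_add, hσ, add_comm]
  set z := σ x - x with hz
  have hσz : σ z = -z := by simp [hz, hσ]
  have hzx : z = (x + σ x) - (2 : K) • x := by rw [hz, two_smul]; abel
  have hzn : z ∈ h.normalizer := by
    rw [hzx]
    exact sub_mem (h.le_normalizer (hadd x)) (h.normalizer.smul_mem 2 hx)
  have hcent {y : g} (hy : y ∈ h) : ⁅z, y⁆ = 0 := by
    have hfix := (hmem _).mp ((h.mem_normalizer_iff z).mp hzn y hy)
    rw [LieHom.map_lie, hσz, (hmem y).mp hy, neg_lie] at hfix
    exact eq_zero_of_eq_neg hfix.symm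
  have hsq (u : g) : ⁅z, ⁅z, u⁆⁆ = 0 := by
    have hσu : ⁅z, σ u⁆ = -⁅z, u⁆ := by
      rw [← add_eq_zero_iff_eq_neg, ← lie_add, add_comm]
      exact hcent (hadd u)
    refine hcent ((hmem _).mpr ?_)
    rw [LieHom.map_lie, hσz, neg_lie, hσu, neg_neg]
  exact (hmem x).mpr (sub_eq_zero.mp (LieAlgebra.IsKilling.eq_zero_of_lie_lie_eq_zero (K := K) hsq))
end

section
/- Let K be a field of characteristic zero, let g be a finite-dimensional semisimple Lie algebra over K, let σ : g → g be a Lie algebra automorphism with σ ∘ σ = id, let h = {x ∈ g : σ(x) = x} and q = {x ∈ g : σ(x) = −x}. Then the centralizer of h in q is zero: if v ∈ q satisfies [v, y] = 0 for all y ∈ h, then v = 0. -/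
/-- For an involutive automorphism σ of a finite-dimensional semisimple Lie algebra over a
field of characteristic zero, the centralizer of the fixed-point subalgebra inside the
(−1)-eigenspace is zero. -/
theorem centralizer_of_fixed_points_in_odd_part_eq_zero
    (K : Type*) [Field K] [CharZero K]
    (g : Type*) [LieRing g] [LieAlgebra K g] [Module.Finite K g]
    [LieAlgebra.IsSemisimple K g]
    (σ : g →ₗ⁅K⁆ g) (hσ : ∀ x, σ (σ x) = x)
    (v : g) (hv : σ v = -v) (hcent : ∀ y : g, σ y = y → ⁅v, y⁆ = 0) :
    v = 0 := by
  have fixed_add (x : g) : σ (x + σ x) = x + σ x := by rw [map_add, hσ, add_comm]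
  have σ_killing (x y : g) : killingForm K g (σ x) (σ y) = killingForm K g x y :=
    LieAlgebra.killingForm_of_equiv_apply
      ({ σ with invFun := σ, left_inv := hσ, right_inv := hσ } : g ≃ₗ⁅K⁆ g) x y
  have lie_fixed (x : g) : σ ⁅v, x⁆ = ⁅v, x⁆ := by
    have h := hcent _ (fixed_add x)
    rw [lie_add] at h
    rw [LieHom.map_lie, hv, neg_lie, eq_neg_of_add_eq_zero_left h]
  have lie_eq_zero (x : g) : ⁅v, x⁆ = 0 := by
    refine (LieAlgebra.IsKilling.killingForm_nondegenerate K g).1 _ fun y => ?_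
    have h : killingForm K g ⁅v, x⁆ (y + σ y) = 0 := by
      rw [LieModule.traceForm_apply_lie_apply', hcent _ (fixed_add y), map_zero, neg_zero]
    have h_eq := σ_killing ⁅v, x⁆ y
    rw [lie_fixed] at h_eq
    rw [map_add, h_eq] at h
    exact add_self_eq_zero.mp h
  have mem_center : v ∈ LieAlgebra.center K g := by
    rw [LieModule.mem_maxTrivSubmodule]
    intro x
    rw [← lie_skew, lie_eq_zero, neg_zero]
  simpa using mem_center
end
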